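/- The filtration F is immersed in G under P if and only if for every t ≥ 0 and every bounded F_∞-measurable random variable X, one has E[X | G_t] = E[X | F_t] P-almost surely. -/

import Mathlib

open MeasureTheory Set
open scoped NNReal ENNReal

noncomputable section

namespace DefaultTimes

variable {Ω : Type*}

/-- The progressively enlarged filtration
`G_t = ⋂_{u>t} (F_u ∨ σ(τ ∧ s : s ≤ u))`. -/
def enlargedFiltration {m0 : MeasurableSpace Ω}
    (F : Filtration ℝ≥0 m0) (τ : Ω → ℝ≥0∞) (hτ : Measurable τ) :
    Filtration ℝ≥0 m0 where
  seq t := ⨅ u ∈ Set.Ioi t, (F u ⊔ ⨆ s ∈ Set.Iic u,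
      MeasurableSpace.comap (fun ω => min (τ ω) (s : ℝ≥0∞)) inferInstance)
  mono' := fun i j hij => le_iInf₂ fun u hu => iInf₂_le u (lt_of_le_of_lt hij hu)
  le' := fun t => by
    refine le_trans (iInf₂_le (t + 1) (lt_add_of_pos_right t one_pos)) ?_
    exact sup_le (Filtration.le _ _)
      (iSup₂_le fun s _ => Measurable.comap_le (hτ.min measurable_const))

/-- `F` is immersed in `G` under `μ` ((H)-hypothesis): every `(F,μ)`-martingale is
a `(G,μ)`-martingale. -/
def Immersion {m0 : MeasurableSpace Ω} (F G : Filtration ℝ≥0 m0) (μ : Measure Ω) : Prop :=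
  ∀ f : ℝ≥0 → Ω → ℝ, Martingale f F μ → Martingale f G μ

open Filter Topology

theorem le_enlargedFiltration {m0 : MeasurableSpace Ω} (F : Filtration ℝ≥0 m0) (τ : Ω → ℝ≥0∞)
    (hτ : Measurable τ) : F ≤ enlargedFiltration F τ hτ :=
  fun _ => le_iInf₂ fun _ hu => (F.mono (le_of_lt hu)).trans le_sup_left

/-- If the conditional expectations given `m₁` and `m₂` agree for bounded `m`-measurable functions,
then they agree for integrable `m`-measurable functions. -/
theorem condExp_ae_eq_of_forall_bounded {m m₁ m₂ m0 : MeasurableSpace Ω} {μ : Measure Ω}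
    [IsFiniteMeasure μ] (hm : m ≤ m0) (hm₁ : m₁ ≤ m0) (hm₂ : m₂ ≤ m0)
    (h : ∀ X : Ω → ℝ, Measurable[m] X → (∃ C, ∀ ω, |X ω| ≤ C) → μ[X|m₁] =ᵐ[μ] μ[X|m₂])
    {f : Ω → ℝ} (hf : Integrable f μ) (hfm : Measurable[m] f) :
    μ[f|m₁] =ᵐ[μ] μ[f|m₂] := by
  set X : ℕ → Ω → ℝ := fun n => {ω | |f ω| ≤ n}.indicator f with hX
  have hXm (n : ℕ) : Measurable[m] (X n) :=
    hfm.indicator (hfm (measurableSet_le measurable_norm measurable_const))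
  have hXb (n : ℕ) : ∃ C, ∀ ω, |X n ω| ≤ C := by
    refine ⟨n, fun ω => ?_⟩
    by_cases hω : |f ω| ≤ n <;> simp [hX, hω]
  have hXlim : ∀ᵐ ω ∂μ, Tendsto (fun n => X n ω) atTop (𝓝 (f ω)) := by
    refine ae_of_all _ fun ω => tendsto_const_nhds.congr' ?_
    obtain ⟨N, hN⟩ := exists_nat_ge |f ω|
    filter_upwards [eventually_ge_atTop N] with n hn
    have hω : |f ω| ≤ n := hN.trans (Nat.cast_le.2 hn)
    simp [hX, hω]
  have hlim {m' : MeasurableSpace Ω} (hm' : m' ≤ m0) :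
      Tendsto (fun n => condExpL1 hm' μ (X n)) atTop (𝓝 (condExpL1 hm' μ f)) :=
    tendsto_condExpL1_of_dominated_convergence hm' (fun ω => ‖f ω‖)
      (fun n => ((hXm n).mono hm le_rfl).aestronglyMeasurable) hf.norm
      (fun n => ae_of_all _ fun ω => norm_indicator_le_norm_self _ _) hXlim
  have heq (n : ℕ) : condExpL1 hm₁ μ (X n) = condExpL1 hm₂ μ (X n) :=
    Lp.ext <| (condExp_ae_eq_condExpL1 hm₁ _).symm.trans <|
      (h _ (hXm n) (hXb n)).trans (condExp_ae_eq_condExpL1 hm₂ _)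
  have hL1 : condExpL1 hm₁ μ f = condExpL1 hm₂ μ f :=
    tendsto_nhds_unique (hlim hm₁) ((hlim hm₂).congr fun n => (heq n).symm)
  refine (condExp_ae_eq_condExpL1 hm₁ f).trans ?_
  rw [hL1]
  exact (condExp_ae_eq_condExpL1 hm₂ f).symm

/-- Lévy's upward theorem along the times `t + n` of a filtration indexed by `ℝ≥0`. -/
theorem tendsto_ae_condExp_add_nat {m0 : MeasurableSpace Ω} {μ : Measure Ω} [IsFiniteMeasure μ]
    (F : Filtration ℝ≥0 m0) (t : ℝ≥0) {X : Ω → ℝ} (hX : Integrable X μ)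
    (hXm : StronglyMeasurable[⨆ s, F s] X) :
    ∀ᵐ ω ∂μ, Tendsto (fun n : ℕ => (μ[X|F (t + n)]) ω) atTop (𝓝 (X ω)) := by
  let F' : Filtration ℕ m0 :=
    { seq := fun n => F (t + n)
      mono' := fun i j hij => F.mono (by gcongr)
      le' := fun n => F.le _ }
  refine hX.tendsto_ae_condExp (ℱ := F') (hXm.mono (iSup_le fun s => ?_))
  obtain ⟨n, hn⟩ := exists_nat_ge s
  exact (F.mono (hn.trans le_add_self)).trans (le_iSup F' n)

/-- Under immersion, conditioning a bounded `F_∞`-measurable variable on `G t` or `F t` gives the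
same result. -/
theorem Immersion.condExp_ae_eq {m0 : MeasurableSpace Ω} {μ : Measure Ω} [IsFiniteMeasure μ]
    {F G : Filtration ℝ≥0 m0} (hFG : F ≤ G) (h : Immersion F G μ) (t : ℝ≥0) {X : Ω → ℝ}
    (hXm : Measurable[⨆ s, F s] X) (hXb : ∃ C, ∀ ω, |X ω| ≤ C) :
    μ[X|G t] =ᵐ[μ] μ[X|F t] := by
  obtain ⟨C, hC⟩ := hXb
  have hX : Integrable X μ :=
    Integrable.of_bound (hXm.mono (iSup_le F.le) le_rfl).aestronglyMeasurable C (ae_of_all _ hC)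
  have hM : Martingale (fun s => μ[X|F s]) G μ := h _ (martingale_condExp X F μ)
  have hFt : μ[μ[X|F t]|G t] = μ[X|F t] :=
    condExp_of_stronglyMeasurable (G.le t) (stronglyMeasurable_condExp.mono (hFG t))
      integrable_condExp
  rw [← hFt]
  refine tendsto_condExp_unique (fun n : ℕ => μ[X|F (t + n)]) (fun _ => μ[X|F t]) _ _
    (fun _ => integrable_condExp) (fun _ => integrable_condExp)
    (tendsto_ae_condExp_add_nat F t hX hXm.stronglyMeasurable)
    (ae_of_all _ fun _ => tendsto_const_nhds) (fun _ => C) (integrable_const _)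
    (fun _ => C) (integrable_const _)
    (fun _ => ae_bdd_abs_condExp_of_ae_bdd_abs (ae_of_all _ hC))
    (fun _ => ae_bdd_abs_condExp_of_ae_bdd_abs (ae_of_all _ hC)) fun n => ?_
  rw [hFt]
  exact hM.condExp_ae_eq le_self_add

theorem stmt_1 {m0 : MeasurableSpace Ω} (P : Measure Ω) [IsProbabilityMeasure P]
    (F : Filtration ℝ≥0 m0) (τ : Ω → ℝ≥0∞) (hτ : Measurable τ) :
    Immersion F (enlargedFiltration F τ hτ) P ↔
      ∀ (t : ℝ≥0) (X : Ω → ℝ),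
        Measurable[⨆ s, F s] X → (∃ C, ∀ ω, |X ω| ≤ C) →
        P[X|enlargedFiltration F τ hτ t] =ᵐ[P] P[X|F t] := by
  have hFG := le_enlargedFiltration F τ hτ
  refine ⟨fun h t X hXm hXb => h.condExp_ae_eq hFG t hXm hXb, fun h f hf => ?_⟩
  refine ⟨fun t => (hf.stronglyMeasurable t).mono (hFG t), fun i j hij => ?_⟩
  exact (condExp_ae_eq_of_forall_bounded (iSup_le F.le) (Filtration.le _ i) (F.le i) (h i)
    (hf.integrable j) ((hf.stronglyMeasurable j).measurable.mono (le_iSup F j) le_rfl)).trans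
    (hf.condExp_ae_eq hij)

end DefaultTimes
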